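/- Let w : ℝ² → ℝ be a smooth function of the variables (t,x) that solves the potential Burgers equation ∂_t w = ∂_x² w + (∂_x w)². Then for all k, l ∈ ℕ the function η := G̃^k P̃^l 1 (the operators applied to the constant function 1) satisfies the linearized potential Burgers equation ∂_t η = ∂_x² η + 2·(∂_x w)·(∂_x η). (This is the claim of Theorem 2 that each 𝔔̃^{kl} = (G̃^k P̃^l 1)∂_w is a generalized symmetry of the potential Burgers equation.) -/

import Mathlib

/-- The operator `P̃ = ∂ₓ + wₓ` associated with `w`. -/
noncomputable def potP (w f : ℝ → ℝ → ℝ) : ℝ → ℝ → ℝ :=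
  fun t x => deriv (f t) x + deriv (w t) x * f t x

/-- The operator `G̃ = t P̃ + x/2` associated with `w`. -/
noncomputable def potG (w f : ℝ → ℝ → ℝ) : ℝ → ℝ → ℝ :=
  fun t x => t * potP w f t x + x / 2 * f t x

open Function in
/-- The space derivative at fixed time, as a value of the Fréchet derivative. -/
theorem hasDerivAt_snd_of_contDiff {f : ℝ → ℝ → ℝ} (hf : ContDiff ℝ (⊤ : ℕ∞) (uncurry f))
    (t x : ℝ) : HasDerivAt (f t) (fderiv ℝ (uncurry f) (t, x) (0, 1)) x := by
  have h := (hf.differentiable (by simp) (t, x)).hasFDerivAt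
  exact h.comp_hasDerivAt (f := fun y : ℝ => (t, y)) x
    ((hasDerivAt_const x t).prodMk (hasDerivAt_id x))

open Function in
/-- The time derivative at a fixed point, as a value of the Fréchet derivative. -/
theorem hasDerivAt_fst_of_contDiff {f : ℝ → ℝ → ℝ} (hf : ContDiff ℝ (⊤ : ℕ∞) (uncurry f))
    (t x : ℝ) : HasDerivAt (fun s => f s x) (fderiv ℝ (uncurry f) (t, x) (1, 0)) t := by
  have h := (hf.differentiable (by simp) (t, x)).hasFDerivAt
  exact h.comp_hasDerivAt (f := fun s : ℝ => (s, x)) t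
    ((hasDerivAt_id t).prodMk (hasDerivAt_const t x))

open Function in
theorem contDiff_uncurry_deriv_snd {f : ℝ → ℝ → ℝ} (hf : ContDiff ℝ (⊤ : ℕ∞) (uncurry f)) :
    ContDiff ℝ (⊤ : ℕ∞) (uncurry fun t x => deriv (f t) x) := by
  have h : (uncurry fun t x => deriv (f t) x) = fun p => fderiv ℝ (uncurry f) p (0, 1) := by
    ext ⟨t, x⟩
    exact (hasDerivAt_snd_of_contDiff hf t x).deriv
  rw [h]
  exact (hf.fderiv_right (by simp)).clm_apply contDiff_const

open Function in
/-- Mixed partial derivatives of a smooth function of two real variables commute. -/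
theorem deriv_deriv_comm_of_contDiff {f : ℝ → ℝ → ℝ} (hf : ContDiff ℝ (⊤ : ℕ∞) (uncurry f))
    (t x : ℝ) : deriv (fun s => deriv (f s) x) t = deriv (fun y => deriv (fun s => f s y) t) x := by
  have h2 : HasFDerivAt (fderiv ℝ (uncurry f)) (fderiv ℝ (fderiv ℝ (uncurry f)) (t, x)) (t, x) :=
    ((hf.fderiv_right (m := (⊤ : ℕ∞)) (by simp)).differentiable (by simp) (t, x)).hasFDerivAt
  have ht := (h2.comp_hasDerivAt (f := fun s : ℝ => (s, x)) t
    ((hasDerivAt_id t).prodMk (hasDerivAt_const t x))).clm_apply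
      (hasDerivAt_const t ((0, 1) : ℝ × ℝ))
  have hx := (h2.comp_hasDerivAt (f := fun y : ℝ => (t, y)) x
    ((hasDerivAt_const x t).prodMk (hasDerivAt_id x))).clm_apply
      (hasDerivAt_const x ((1, 0) : ℝ × ℝ))
  have hsymm := second_derivative_symmetric
    (fun p => (hf.differentiable (by simp) p).hasFDerivAt) h2 (1, 0) (0, 1)
  simp only [(hasDerivAt_snd_of_contDiff hf _ _).deriv, (hasDerivAt_fst_of_contDiff hf _ _).deriv]
  refine ht.deriv.trans (Eq.trans ?_ hx.deriv.symm)
  simpa using hsymm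

open Function in
theorem contDiff_potP {w f : ℝ → ℝ → ℝ} (hw : ContDiff ℝ (⊤ : ℕ∞) (uncurry w))
    (hf : ContDiff ℝ (⊤ : ℕ∞) (uncurry f)) : ContDiff ℝ (⊤ : ℕ∞) (uncurry (potP w f)) :=
  (contDiff_uncurry_deriv_snd hf).add ((contDiff_uncurry_deriv_snd hw).mul hf)

open Function in
theorem contDiff_potG {w f : ℝ → ℝ → ℝ} (hw : ContDiff ℝ (⊤ : ℕ∞) (uncurry w))
    (hf : ContDiff ℝ (⊤ : ℕ∞) (uncurry f)) : ContDiff ℝ (⊤ : ℕ∞) (uncurry (potG w f)) :=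
  (contDiff_fst.mul (contDiff_potP hw hf)).add ((contDiff_snd.div_const 2).mul hf)

/-- `f` is a smooth solution of the potential Burgers equation linearized along `w`. -/
def IsSmoothLinearizedSolution (w f : ℝ → ℝ → ℝ) : Prop :=
  ContDiff ℝ (⊤ : ℕ∞) (Function.uncurry f) ∧
    ∀ t x, deriv (fun s => f s x) t
      = deriv (deriv (f t)) x + 2 * deriv (w t) x * deriv (f t) x

open Function in
/-- `P̃` is a recursion operator: it preserves solutions of the linearized equation. -/
theorem IsSmoothLinearizedSolution.potP {w f : ℝ → ℝ → ℝ}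
    (hw : ContDiff ℝ (⊤ : ℕ∞) (uncurry w))
    (hpb : ∀ t x, deriv (fun s => w s x) t = deriv (deriv (w t)) x + (deriv (w t) x) ^ 2)
    (hf : IsSmoothLinearizedSolution w f) : IsSmoothLinearizedSolution w (potP w f) := by
  obtain ⟨hf, hL⟩ := hf
  refine ⟨contDiff_potP hw hf, fun t x => ?_⟩
  have hdx {g : ℝ → ℝ → ℝ} (hg : ContDiff ℝ (⊤ : ℕ∞) (uncurry g)) (y : ℝ) :
      HasDerivAt (g t) (deriv (g t) y) y :=
    (hasDerivAt_snd_of_contDiff hg t y).differentiableAt.hasDerivAt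
  have hdt {g : ℝ → ℝ → ℝ} (hg : ContDiff ℝ (⊤ : ℕ∞) (uncurry g)) :
      HasDerivAt (fun s => g s x) (deriv (fun s => g s x) t) t :=
    (hasDerivAt_fst_of_contDiff hg t x).differentiableAt.hasDerivAt
  have hf₁ := contDiff_uncurry_deriv_snd hf
  have hf₂ := contDiff_uncurry_deriv_snd hf₁
  have hw₁ := contDiff_uncurry_deriv_snd hw
  have hw₂ := contDiff_uncurry_deriv_snd hw₁
  have hfxt : deriv (fun s => deriv (f s) x) t = deriv (deriv (deriv (f t))) x
      + (2 * deriv (deriv (w t)) x * deriv (f t) x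
        + 2 * deriv (w t) x * deriv (deriv (f t)) x) := by
    rw [deriv_deriv_comm_of_contDiff hf]
    simp only [hL]
    exact ((hdx hf₂ x).add (((hdx hw₁ x).const_mul 2).mul (hdx hf₁ x))).deriv
  have hwxt : deriv (fun s => deriv (w s) x) t = deriv (deriv (deriv (w t))) x
      + 2 * deriv (w t) x * deriv (deriv (w t)) x := by
    rw [deriv_deriv_comm_of_contDiff hw]
    simp only [hpb]
    refine ((hdx hw₂ x).add ((hdx hw₁ x).pow 2)).deriv.trans ?_
    simp
  have hPt : deriv (fun s => _root_.potP w f s x) t = deriv (fun s => deriv (f s) x) t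
      + (deriv (fun s => deriv (w s) x) t * f t x + deriv (w t) x * deriv (fun s => f s x) t) :=
    ((hdt hf₁).add ((hdt hw₁).mul (hdt hf))).deriv
  have hPx : deriv (_root_.potP w f t) = fun y => deriv (deriv (f t)) y
      + (deriv (deriv (w t)) y * f t y + deriv (w t) y * deriv (f t) y) :=
    funext fun y => ((hdx hf₁ y).add ((hdx hw₁ y).mul (hdx hf y))).deriv
  have hPxx : deriv (deriv (_root_.potP w f t)) x = deriv (deriv (deriv (f t))) x
      + ((deriv (deriv (deriv (w t))) x * f t x + deriv (deriv (w t)) x * deriv (f t) x)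
        + (deriv (deriv (w t)) x * deriv (f t) x + deriv (w t) x * deriv (deriv (f t)) x)) := by
    rw [hPx]
    exact ((hdx hf₂ x).add (((hdx hw₂ x).mul (hdx hf x)).add ((hdx hw₁ x).mul (hdx hf₁ x)))).deriv
  rw [hPxx, hPt, hPx, hfxt, hwxt, hL]
  ring

open Function in
/-- `G̃` is a recursion operator: it preserves solutions of the linearized equation. -/
theorem IsSmoothLinearizedSolution.potG {w f : ℝ → ℝ → ℝ}
    (hw : ContDiff ℝ (⊤ : ℕ∞) (uncurry w))
    (hpb : ∀ t x, deriv (fun s => w s x) t = deriv (deriv (w t)) x + (deriv (w t) x) ^ 2)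
    (hf : IsSmoothLinearizedSolution w f) : IsSmoothLinearizedSolution w (potG w f) := by
  obtain ⟨hg, hLg⟩ := hf.potP hw hpb
  obtain ⟨hf, hL⟩ := hf
  refine ⟨contDiff_potG hw hf, fun t x => ?_⟩
  have hdx {g : ℝ → ℝ → ℝ} (hg : ContDiff ℝ (⊤ : ℕ∞) (uncurry g)) (y : ℝ) :
      HasDerivAt (g t) (deriv (g t) y) y :=
    (hasDerivAt_snd_of_contDiff hg t y).differentiableAt.hasDerivAt
  have hdt {g : ℝ → ℝ → ℝ} (hg : ContDiff ℝ (⊤ : ℕ∞) (uncurry g)) :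
      HasDerivAt (fun s => g s x) (deriv (fun s => g s x) t) t :=
    (hasDerivAt_fst_of_contDiff hg t x).differentiableAt.hasDerivAt
  have hf₁ := contDiff_uncurry_deriv_snd hf
  have hg₁ := contDiff_uncurry_deriv_snd hg
  have hhalf (y : ℝ) : HasDerivAt (fun y : ℝ => y / 2) (1 / 2) y := (hasDerivAt_id y).div_const 2
  have hGt : deriv (fun s => _root_.potG w f s x) t
      = (1 * _root_.potP w f t x + t * deriv (fun s => _root_.potP w f s x) t)
        + x / 2 * deriv (fun s => f s x) t :=
    (((hasDerivAt_id t).mul (hdt hg)).add ((hdt hf).const_mul (x / 2))).deriv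
  have hGx : deriv (_root_.potG w f t) = fun y => t * deriv (_root_.potP w f t) y
      + (1 / 2 * f t y + y / 2 * deriv (f t) y) :=
    funext fun y => (((hdx hg y).const_mul t).add ((hhalf y).mul (hdx hf y))).deriv
  have hGxx : deriv (deriv (_root_.potG w f t)) x = t * deriv (deriv (_root_.potP w f t)) x
      + (1 / 2 * deriv (f t) x + (1 / 2 * deriv (f t) x + x / 2 * deriv (deriv (f t)) x)) := by
    rw [hGx]
    exact (((hdx hg₁ x).const_mul t).add
      (((hdx hf x).const_mul (1 / 2)).add ((hhalf x).mul (hdx hf₁ x)))).deriv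
  rw [hGxx, hGt, hGx, hLg, hL]
  simp only [_root_.potP]
  ring

/-- If a smooth `w : ℝ² → ℝ` solves the potential Burgers equation
`∂ₜ w = ∂ₓ² w + (∂ₓ w)²`, then for all `k, l ∈ ℕ` the function `η := G̃^k P̃^l 1`
satisfies the linearized potential Burgers equation `∂ₜ η = ∂ₓ² η + 2 (∂ₓ w)(∂ₓ η)`;
i.e., each `𝔔̃^{kl} = (G̃^k P̃^l 1) ∂_w` is a generalized symmetry of the potential
Burgers equation. -/
theorem potential_burgers_generalized_symmetries
    (w : ℝ → ℝ → ℝ)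
    (hw : ContDiff ℝ (⊤ : ℕ∞) (Function.uncurry w))
    (hpb : ∀ t x, deriv (fun s => w s x) t
        = deriv (deriv (w t)) x + (deriv (w t) x) ^ 2)
    (k l : ℕ)
    (η : ℝ → ℝ → ℝ)
    (hη : η = (potG w)^[k] ((potP w)^[l] (fun _ _ => (1 : ℝ)))) :
    ∀ t x, deriv (fun s => η s x) t
      = deriv (deriv (η t)) x + 2 * deriv (w t) x * deriv (η t) x := by
  have h₁ : IsSmoothLinearizedSolution w (fun _ _ => (1 : ℝ)) :=
    ⟨contDiff_const, fun t x => by simp⟩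
  have hP : IsSmoothLinearizedSolution w ((potP w)^[l] (fun _ _ => (1 : ℝ))) :=
    Function.Iterate.rec _ h₁ (fun _ h => h.potP hw hpb) l
  have hG : IsSmoothLinearizedSolution w η :=
    hη ▸ Function.Iterate.rec _ hP (fun _ h => h.potG hw hpb) k
  exact hG.2
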